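/- arXiv:2409.19547 — 5 statements merged into one kernel-verified Lean document; each statement's English description precedes it below -/
import Mathlib

section
/- For every integer n ≥ 2, the number of desarrangements of length n avoiding the pattern 123 equals the Fine number F_{n+1}, i.e. d_n({123}) = F_{n+1}. -/
open scoped Classical

/-- Index `i ∈ {1,…,n}` (1-indexed) is an ascent of the permutation `π` of length `n`,
written in one-line notation `π₁π₂⋯πₙ` with `πᵢ = π ⟨i-1, _⟩`: either `i = n`, or
`πᵢ < πᵢ₊₁`. -/
def IsAscent (n : ℕ) (π : Equiv.Perm (Fin n)) (i : ℕ) : Prop :=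
  1 ≤ i ∧ i ≤ n ∧ (i = n ∨ ∃ h : i < n, π ⟨i - 1, by omega⟩ < π ⟨i, h⟩)

/-- A permutation is a desarrangement if it is empty or its first (smallest) ascent is even. -/
def IsDesarrangement (n : ℕ) (π : Equiv.Perm (Fin n)) : Prop :=
  n = 0 ∨ ∃ i, IsAscent n π i ∧ Even i ∧ ∀ j, IsAscent n π j → i ≤ j

/-- `π` contains the pattern `σ` (where `σ` is given in 0-indexed one-line notation):
there are positions `i₁ < ⋯ < i_k` such that the letters of `π` at these positions are
in the same relative order as the letters of `σ`. -/
def ContainsPattern {k n : ℕ} (σ : Fin k → Fin k) (π : Equiv.Perm (Fin n)) : Prop :=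
  ∃ f : Fin k ↪o Fin n, ∀ a b : Fin k, π (f a) < π (f b) ↔ σ a < σ b

/-- `d_n(P)`: the number of desarrangements of length `n` avoiding every pattern in `P`
(patterns of length 3, in 0-indexed one-line notation). -/
noncomputable def dcount (n : ℕ) (P : Finset (Fin 3 → Fin 3)) : ℕ :=
  (Finset.univ.filter fun π : Equiv.Perm (Fin n) =>
    IsDesarrangement n π ∧ ∀ σ ∈ P, ¬ ContainsPattern σ π).card

/-- `π` has no increasing subsequence of length three. -/
def Avoids123 {n : ℕ} (π : Equiv.Perm (Fin n)) : Prop :=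
  ∀ i j l : Fin n, i < j → j < l → π i < π j → ¬ π j < π l

/-- The first `k` letters of `π` are decreasing. -/
def DecreasingPrefix {n : ℕ} (k : ℕ) (π : Equiv.Perm (Fin n)) : Prop :=
  k ≤ n ∧ ∀ i j : Fin n, i < j → (j : ℕ) < k → π j < π i

/-- The first ascent of `π`, with value `0` for the empty permutation. -/
noncomputable def firstAscent {n : ℕ} (π : Equiv.Perm (Fin n)) : ℕ :=
  sInf {i | IsAscent n π i}

/-- The number of 123-avoiding permutations of length `n` whose first `k` letters decrease. -/
noncomputable def prefixCount (n k : ℕ) : ℕ :=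
  (Finset.univ.filter fun π : Equiv.Perm (Fin n) => Avoids123 π ∧ DecreasingPrefix k π).card

/-- Insert a new maximal letter into `σ` at position `p`. -/
def insertMax {n : ℕ} (p : Fin (n + 1)) (σ : Equiv.Perm (Fin n)) : Equiv.Perm (Fin (n + 1)) :=
  (finSuccEquiv' p).trans ((Equiv.optionCongr σ).trans (finSuccEquiv' (Fin.last n)).symm)

@[simp] theorem insertMax_self {n : ℕ} (p : Fin (n + 1)) (σ : Equiv.Perm (Fin n)) :
    insertMax p σ p = Fin.last n := by
  simp [insertMax]

@[simp] theorem insertMax_succAbove {n : ℕ} (p : Fin (n + 1)) (σ : Equiv.Perm (Fin n))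
    (i : Fin n) : insertMax p σ (p.succAbove i) = (σ i).castSucc := by
  simp [insertMax]

theorem insertMax_bijective (n : ℕ) :
    Function.Bijective fun x : Fin (n + 1) × Equiv.Perm (Fin n) => insertMax x.1 x.2 := by
  rw [Fintype.bijective_iff_injective_and_card]
  refine ⟨?_, by simp [Fintype.card_perm, Nat.factorial_succ]⟩
  rintro ⟨p, σ⟩ ⟨q, τ⟩ h
  simp only at h
  obtain rfl : p = q := by
    apply (insertMax q τ).injective
    rw [insertMax_self, ← h, insertMax_self]
  congr 1
  ext i
  have := congrArg (fun π => π (p.succAbove i)) h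
  simpa using congrArg Fin.val this

theorem containsPattern_012_iff {n : ℕ} (π : Equiv.Perm (Fin n)) :
    ¬ ContainsPattern (![0, 1, 2] : Fin 3 → Fin 3) π ↔ Avoids123 π := by
  constructor
  · intro h i j l hij hjl h1 h2
    apply h
    have hm : StrictMono (![i, j, l] : Fin 3 → Fin n) := by
      rw [Fin.strictMono_iff_lt_succ]
      intro a
      fin_cases a <;> simpa
    have hp : StrictMono fun a => π ((![i, j, l] : Fin 3 → Fin n) a) := by
      rw [Fin.strictMono_iff_lt_succ]
      intro a
      fin_cases a <;> simpa
    refine ⟨OrderEmbedding.ofStrictMono _ hm, fun a b => ?_⟩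
    have hid : (![0, 1, 2] : Fin 3 → Fin 3) = id := by decide
    rw [hid]
    exact hp.lt_iff_lt
  · rintro h ⟨f, hf⟩
    exact h (f 0) (f 1) (f 2) (f.strictMono (by decide)) (f.strictMono (by decide))
      ((hf 0 1).2 (by decide)) ((hf 1 2).2 (by decide))

theorem avoids123_insertMax_iff {n : ℕ} (p : Fin (n + 1)) (σ : Equiv.Perm (Fin n)) :
    Avoids123 (insertMax p σ) ↔ Avoids123 σ ∧ DecreasingPrefix p σ := by
  constructor
  · intro h
    refine ⟨fun i j l hij hjl h1 h2 => ?_, Nat.lt_succ_iff.1 p.2, fun i j hij hj => ?_⟩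
    · exact h (p.succAbove i) (p.succAbove j) (p.succAbove l) (by simpa) (by simpa)
        (by simpa) (by simpa)
    · by_contra hlt
      have hne : σ i < σ j := lt_of_le_of_ne (not_lt.1 hlt) (σ.injective.ne hij.ne)
      refine h (p.succAbove i) (p.succAbove j) p (by simpa) ?_ (by simpa) (by simp)
      rw [Fin.succAbove_of_castSucc_lt _ _ (by simpa [Fin.lt_def] using hj)]
      simpa [Fin.lt_def] using hj
  · rintro ⟨h, -, hd⟩ i j l hij hjl h1 h2
    rcases Fin.eq_self_or_eq_succAbove p i with rfl | ⟨i, rfl⟩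
    · simp [Fin.not_lt.2 (Fin.le_last _)] at h1
    rcases Fin.eq_self_or_eq_succAbove p j with rfl | ⟨j, rfl⟩
    · simp [Fin.not_lt.2 (Fin.le_last _)] at h2
    rcases Fin.eq_self_or_eq_succAbove p l with rfl | ⟨l, rfl⟩
    · simp only [Fin.succAbove_lt_succAbove_iff, insertMax_succAbove,
        Fin.castSucc_lt_castSucc_iff] at hij h1
      have hj : (j : ℕ) < l := by
        rw [Fin.succAbove_lt_iff_castSucc_lt] at hjl
        simpa [Fin.lt_def] using hjl
      exact lt_asymm h1 (hd i j hij hj)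
    · simp only [Fin.succAbove_lt_succAbove_iff, insertMax_succAbove,
        Fin.castSucc_lt_castSucc_iff] at hij hjl h1 h2
      exact h i j l hij hjl h1 h2

theorem decreasingPrefix_insertMax_iff {n : ℕ} (k : ℕ) (p : Fin (n + 1))
    (σ : Equiv.Perm (Fin n)) (hσ : DecreasingPrefix p σ) :
    DecreasingPrefix (k + 1) (insertMax p σ) ↔
      (p = 0 ∧ DecreasingPrefix k σ) ∨ k + 1 ≤ (p : ℕ) := by
  constructor
  · rintro ⟨hk, h⟩
    rcases Nat.lt_or_ge k p with hp | hp
    · exact Or.inr hp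
    · left
      obtain rfl : p = 0 := by
        by_contra hp0
        have := h 0 p (Fin.pos_of_ne_zero hp0) (by omega)
        simp [Fin.not_lt.2 (Fin.le_last _)] at this
      refine ⟨rfl, by omega, fun i j hij hj => ?_⟩
      have := h (Fin.succAbove 0 i) (Fin.succAbove 0 j) (by simpa) (by simpa)
      simpa only [insertMax_succAbove, Fin.castSucc_lt_castSucc_iff] using this
  · rintro (⟨rfl, hk, h⟩ | hp)
    · refine ⟨by omega, fun i j hij hj => ?_⟩
      rcases Fin.eq_self_or_eq_succAbove 0 j with rfl | ⟨j, rfl⟩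
      · exact absurd hij (Fin.not_lt_zero i)
      rcases Fin.eq_self_or_eq_succAbove 0 i with rfl | ⟨i, rfl⟩
      · simp only [insertMax_self, insertMax_succAbove]
        exact Fin.castSucc_lt_last _
      · simp only [insertMax_succAbove, Fin.castSucc_lt_castSucc_iff]
        exact h i j (by simpa using hij) (by simpa using hj)
    · refine ⟨by omega, fun i j hij hj => ?_⟩
      have hval : ∀ a : Fin (n + 1), a < p → ∃ b : Fin n, a = p.succAbove b ∧ (b : ℕ) = a := by
        intro a ha
        refine ⟨a.castPred (ha.trans_le (Fin.le_last p)).ne, ?_, by simp⟩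
        rw [Fin.succAbove_of_castSucc_lt] <;> simp [ha]
      have hjp : j < p := by rw [Fin.lt_def]; omega
      obtain ⟨i, rfl, hi⟩ := hval i (hij.trans hjp)
      obtain ⟨j, rfl, hj'⟩ := hval j hjp
      simp only [insertMax_succAbove, Fin.castSucc_lt_castSucc_iff]
      exact hσ.2 i j (by simpa using hij) (by omega)

theorem prefixCount_eq_zero {n k : ℕ} (h : n < k) : prefixCount n k = 0 := by
  rw [prefixCount, Finset.card_eq_zero, Finset.filter_eq_empty_iff]
  rintro π - ⟨-, hk, -⟩
  omega

theorem prefixCount_zero_zero : prefixCount 0 0 = 1 := by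
  rw [prefixCount, Finset.filter_true_of_mem, Finset.card_univ, Fintype.card_perm]
  · simp
  · exact fun π _ => ⟨fun i => i.elim0, le_rfl, fun i => i.elim0⟩

theorem prefixCount_succ_zero (n : ℕ) : prefixCount (n + 1) 0 = prefixCount (n + 1) 1 := by
  rw [prefixCount, prefixCount]
  congr 1
  refine Finset.filter_congr fun π _ => and_congr_right fun _ => ?_
  refine ⟨fun _ => ⟨by omega, fun i j hij hj => ?_⟩, fun _ => ⟨by omega, fun i j hij hj => ?_⟩⟩
  · rw [Fin.lt_def] at hij
    omega
  · omega

theorem prefixCount_succ_succ_eq_sum (n k : ℕ) : prefixCount (n + 1) (k + 1) =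
    prefixCount n k + ∑ p ∈ Finset.Ico (k + 1) (n + 1), prefixCount n p := by
  have key : prefixCount (n + 1) (k + 1) = ∑ p : Fin (n + 1),
      ((if p = 0 then prefixCount n k else 0) +
        if k + 1 ≤ (p : ℕ) then prefixCount n p else 0) := by
    rw [prefixCount, Finset.card_filter,
      ← (insertMax_bijective n).sum_comp fun π => if Avoids123 π ∧ DecreasingPrefix (k + 1) π
        then 1 else 0, Fintype.sum_prod_type]
    refine Finset.sum_congr rfl fun p _ => ?_
    have hiff : ∀ σ : Equiv.Perm (Fin n),
        (Avoids123 (insertMax p σ) ∧ DecreasingPrefix (k + 1) (insertMax p σ)) ↔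
          (p = 0 ∧ Avoids123 σ ∧ DecreasingPrefix k σ) ∨
            (k + 1 ≤ (p : ℕ) ∧ Avoids123 σ ∧ DecreasingPrefix p σ) := by
      intro σ
      have hzero : p = 0 → DecreasingPrefix p σ := by
        rintro rfl
        exact ⟨by simp, fun i j _ hj => absurd hj (by simp)⟩
      rw [avoids123_insertMax_iff]
      have := decreasingPrefix_insertMax_iff k p σ
      tauto
    simp only [hiff]
    by_cases hp : p = 0
    · subst hp
      simp [prefixCount]
    · by_cases hk : k + 1 ≤ (p : ℕ) <;> simp [hp, hk, prefixCount]
  rw [key, Finset.sum_add_distrib, Finset.sum_ite_eq' Finset.univ, if_pos (Finset.mem_univ _),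
    Fin.sum_univ_eq_sum_range (fun p => if k + 1 ≤ p then prefixCount n p else 0),
    ← Finset.sum_filter]
  congr 2
  ext p
  simp only [Finset.mem_filter, Finset.mem_range, Finset.mem_Ico]
  omega

theorem prefixCount_succ_succ (n k : ℕ) :
    prefixCount (n + 1) (k + 1) = prefixCount n k + prefixCount (n + 1) (k + 2) := by
  rw [prefixCount_succ_succ_eq_sum, prefixCount_succ_succ_eq_sum n (k + 1)]
  congr 1
  rcases Nat.lt_or_ge (k + 1) (n + 1) with h | h
  · exact Finset.sum_eq_sum_Ico_succ_bot h _
  · rw [Finset.Ico_eq_empty (by omega), Finset.Ico_eq_empty (by omega),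
      prefixCount_eq_zero (by omega)]
    rfl

theorem prefixCount_self (n : ℕ) : prefixCount n n = 1 := by
  induction n with
  | zero => exact prefixCount_zero_zero
  | succ n ih => rw [prefixCount_succ_succ, ih, prefixCount_eq_zero (by omega)]

theorem prefixCount_add_choose (m k : ℕ) :
    prefixCount (m + 1 + k) k + (2 * m + 2 + k).choose m = (2 * m + 2 + k).choose (m + 1) := by
  induction m generalizing k with
  | zero =>
    induction k with
    | zero => simp [prefixCount_succ_zero, prefixCount_self]
    | succ k ih =>
      have h := prefixCount_succ_succ (0 + 1 + k) k
      rw [show 0 + 1 + k + 1 = k + 2 by ring, prefixCount_self] at h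
      rw [show 0 + 1 + (k + 1) = k + 2 by ring, h]
      simp at ih ⊢
      omega
  | succ m ihm =>
    induction k with
    | zero =>
      have h := ihm 1
      have hs : (2 * m + 3).choose (m + 1 + 1) = (2 * m + 3).choose (m + 1) :=
        Nat.choose_symm_of_eq_add (by ring)
      have p1 := Nat.choose_succ_succ (2 * m + 3) (m + 1)
      have p2 := Nat.choose_succ_succ (2 * m + 3) m
      simp only [Nat.succ_eq_add_one] at p1 p2
      rw [show 2 * (m + 1) + 2 + 0 = 2 * m + 3 + 1 by ring, show m + 1 + 1 + 0 = m + 1 + 1 by ring,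
        prefixCount_succ_zero]
      rw [show 2 * m + 2 + 1 = 2 * m + 3 by ring] at h
      omega
    | succ k ih =>
      have h := ihm (k + 2)
      have hr := prefixCount_succ_succ (m + 1 + 1 + k) k
      have p1 := Nat.choose_succ_succ (2 * m + 4 + k) (m + 1)
      have p2 := Nat.choose_succ_succ (2 * m + 4 + k) m
      simp only [Nat.succ_eq_add_one] at p1 p2
      rw [show 2 * (m + 1) + 2 + k = 2 * m + 4 + k by ring] at ih
      rw [show 2 * m + 2 + (k + 2) = 2 * m + 4 + k by ring,
        show m + 1 + (k + 2) = m + 1 + 1 + k + 1 by ring] at h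
      rw [show 2 * (m + 1) + 2 + (k + 1) = 2 * m + 4 + k + 1 by ring,
        show m + 1 + 1 + (k + 1) = m + 1 + 1 + k + 1 by ring]
      omega

theorem prefixCount_zero_eq_catalan (n : ℕ) : prefixCount n 0 = catalan n := by
  cases n with
  | zero => simp [prefixCount_zero_zero]
  | succ m =>
    have h := prefixCount_add_choose m 0
    have hc := succ_mul_catalan_eq_centralBinom (m + 1)
    have hs := Nat.choose_succ_right_eq (2 * m + 2) m
    rw [Nat.centralBinom, show 2 * (m + 1) = 2 * m + 2 by ring] at hc
    rw [show 2 * m + 2 - m = m + 2 by omega] at hs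
    simp only [add_zero] at h
    apply Nat.eq_of_mul_eq_mul_left (show 0 < m + 1 + 1 by omega)
    rw [hc]
    nlinarith

theorem firstAscent_isLeast {n : ℕ} (hn : 0 < n) (π : Equiv.Perm (Fin n)) :
    IsLeast {i | IsAscent n π i} (firstAscent π) :=
  have hne : {i | IsAscent n π i}.Nonempty := ⟨n, hn, le_rfl, Or.inl rfl⟩
  ⟨Nat.sInf_mem hne, fun _ hi => Nat.sInf_le hi⟩

theorem firstAscent_of_isEmpty (π : Equiv.Perm (Fin 0)) : firstAscent π = 0 := by
  have : {i | IsAscent 0 π i} = ∅ := by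
    ext i
    simp only [Set.mem_ofPred_eq, Set.mem_empty_iff_false, iff_false]
    rintro ⟨h1, h2, -⟩
    omega
  rw [firstAscent, this, Nat.sInf_empty]

theorem firstAscent_le {n : ℕ} (π : Equiv.Perm (Fin n)) : firstAscent π ≤ n := by
  rcases Nat.eq_zero_or_pos n with rfl | hn
  · exact (firstAscent_of_isEmpty π).le
  · exact (firstAscent_isLeast hn π).1.2.1

theorem isDesarrangement_iff_even_firstAscent {n : ℕ} (π : Equiv.Perm (Fin n)) :
    IsDesarrangement n π ↔ Even (firstAscent π) := by
  rcases Nat.eq_zero_or_pos n with rfl | hn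
  · simp [IsDesarrangement, firstAscent_of_isEmpty]
  · have hl := firstAscent_isLeast hn π
    constructor
    · rintro (h | ⟨i, hi, he, hm⟩)
      · omega
      · rwa [hl.unique ⟨hi, fun _ hj => hm _ hj⟩]
    · exact fun he => Or.inr ⟨_, hl.1, he, fun _ hj => hl.2 hj⟩

theorem decreasingPrefix_iff_le_firstAscent {n : ℕ} (k : ℕ) (π : Equiv.Perm (Fin n)) :
    DecreasingPrefix k π ↔ k ≤ firstAscent π := by
  constructor
  · rintro ⟨hk, h⟩
    rcases Nat.eq_zero_or_pos n with rfl | hn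
    · omega
    obtain ⟨h1, h2, h3⟩ := (firstAscent_isLeast hn π).1
    by_contra hlt
    rcases h3 with h3 | ⟨h3, h4⟩
    · omega
    · exact lt_asymm h4 (h _ _ (by rw [Fin.lt_def]; simp; omega) (by simp; omega))
  · intro h
    refine ⟨h.trans (firstAscent_le π), fun i j hij hj => ?_⟩
    have hn : 0 < n := i.pos
    have hstep : ∀ a (ha : a + 1 < n), a + 1 < k → π ⟨a + 1, ha⟩ < π ⟨a, by omega⟩ := by
      intro a ha hak
      by_contra hlt
      have hlt' : π ⟨a, by omega⟩ < π ⟨a + 1, ha⟩ :=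
        lt_of_le_of_ne (not_lt.1 hlt) (π.injective.ne (by simp))
      have := (firstAscent_isLeast hn π).2
        (show IsAscent n π (a + 1) from ⟨by omega, ha.le, Or.inr ⟨ha, hlt'⟩⟩)
      omega
    have hdec : ∀ d (hd : (i : ℕ) + d + 1 < n), (i : ℕ) + d + 1 < k →
        π ⟨i + d + 1, hd⟩ < π i := by
      intro d
      induction d with
      | zero => exact fun hd hdk => hstep i hd hdk
      | succ d ih =>
        exact fun hd hdk => (hstep (i + d + 1) hd hdk).trans (ih (by omega) (by omega))
    rw [Fin.lt_def] at hij
    have hj' : j = ⟨i + (j - i - 1) + 1, by omega⟩ := by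
      ext
      simp
      omega
    rw [hj']
    exact hdec _ _ (by omega)

theorem alternating_sum_range_ite_le {n f : ℕ} (h : f ≤ n) :
    ∑ k ∈ Finset.range (n + 1), (if k ≤ f then (-1 : ℤ) ^ k else 0) = if Even f then 1 else 0 := by
  rw [← Finset.sum_filter]
  have : (Finset.range (n + 1)).filter (fun k => k ≤ f) = Finset.range (f + 1) := by
    ext k
    simp only [Finset.mem_filter, Finset.mem_range]
    omega
  rw [this, neg_one_geom_sum]
  simp only [Nat.even_add_one, ite_not]

theorem dcount_eq_alternating_sum (n : ℕ) : (dcount n {![0, 1, 2]} : ℤ) =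
    ∑ k ∈ Finset.range (n + 1), (-1 : ℤ) ^ k * prefixCount n k := by
  have h1 : (dcount n {![0, 1, 2]} : ℤ) = ∑ π : Equiv.Perm (Fin n) with Avoids123 π,
      if Even (firstAscent π) then 1 else 0 := by
    rw [dcount, ← Finset.sum_filter, Finset.filter_filter]
    simp only [Finset.mem_singleton, forall_eq, containsPattern_012_iff,
      isDesarrangement_iff_even_firstAscent, Finset.sum_const, nsmul_eq_mul, mul_one]
    simp only [and_comm]
  rw [h1, Finset.sum_congr rfl fun π _ => (alternating_sum_range_ite_le (firstAscent_le π)).symm,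
    Finset.sum_comm]
  refine Finset.sum_congr rfl fun k _ => ?_
  rw [← Finset.sum_filter, Finset.filter_filter, Finset.sum_const, nsmul_eq_mul, mul_comm,
    prefixCount]
  simp only [decreasingPrefix_iff_le_firstAscent]

theorem two_mul_dcount_succ_add_dcount (n : ℕ) :
    2 * dcount (n + 1) {![0, 1, 2]} + dcount n {![0, 1, 2]} = catalan (n + 1) := by
  have e1 := dcount_eq_alternating_sum (n + 1)
  have e2 : (dcount (n + 1) {![0, 1, 2]} : ℤ) =
      ∑ k ∈ Finset.range (n + 3), (-1 : ℤ) ^ k * prefixCount (n + 1) k := by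
    rw [Finset.sum_range_succ, prefixCount_eq_zero (by omega : n + 1 < n + 2), e1]
    simp
  have e3 := dcount_eq_alternating_sum n
  have hrec : ∀ k, (prefixCount n k : ℤ) =
      prefixCount (n + 1) (k + 1) - prefixCount (n + 1) (k + 2) := by
    intro k
    rw [prefixCount_succ_succ n k]
    push_cast
    ring
  simp only [hrec, mul_sub, Finset.sum_sub_distrib] at e3
  rw [Finset.sum_range_succ'] at e1
  rw [Finset.sum_range_succ', Finset.sum_range_succ'] at e2
  have h0 := prefixCount_succ_zero n
  rw [← prefixCount_zero_eq_catalan]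
  zify at h0 ⊢
  simp only [pow_succ, mul_neg, mul_one, neg_mul, Finset.sum_neg_distrib, neg_neg, pow_zero,
    one_mul, zero_add] at e1 e2 e3
  linarith

theorem dcount_zero : dcount 0 {![0, 1, 2]} = 1 := by
  zify
  rw [dcount_eq_alternating_sum]
  simp [prefixCount_zero_zero]

/-- For every integer `n ≥ 2`, the number of desarrangements of length `n` avoiding the
pattern 123 equals the Fine number `F_(n+1)`, where the Fine numbers are determined by
`F₀ = 0`, `F₁ = 1`, and `C_n = 2·F_(n+1) + F_n` for all `n ≥ 1`. -/
theorem desarrangements_avoiding_123 (F : ℕ → ℕ)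
    (hF0 : F 0 = 0) (hF1 : F 1 = 1)
    (hF : ∀ m : ℕ, 1 ≤ m → catalan m = 2 * F (m + 1) + F m)
    (n : ℕ) (hn : 2 ≤ n) :
    dcount n {![0,1,2]} = F (n + 1) := by
  have h : ∀ m, dcount m {![0, 1, 2]} = F (m + 1) := by
    intro m
    induction m with
    | zero => rw [dcount_zero, hF1]
    | succ m ih =>
      have h1 := two_mul_dcount_succ_add_dcount m
      have h2 := hF (m + 1) (by omega)
      omega
  exact h n
end

section
/- Define a sequence (a_n) by a₀ = 1 and a_{n+1} = C_n − a_n for all n ≥ 0, where C_n is the n-th Catalan number. Then for every integer n ≥ 0 and each pattern σ ∈ {213, 312}, the number of desarrangements of length n avoiding σ equals a_n, i.e. d_n({σ}) = a_n. -/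
open scoped Classical

open List
open BinaryTree hiding nil

/-- The relation between the outer letters of the pattern: `213` for `true`, `312` for `false`. -/
def OuterRel (asc : Bool) (x z : ℕ) : Prop := if asc then x < z else z < x

/-- A word avoids `213` (for `asc = true`) or `312` (for `asc = false`). -/
def AvoidsValley (asc : Bool) (w : List ℕ) : Prop :=
  ∀ x y z, [x, y, z] <+ w → y < x → y < z → ¬ OuterRel asc x z

theorem AvoidsValley.sublist {asc : Bool} {v w : List ℕ} (h : AvoidsValley asc w) (hv : v <+ w) :
    AvoidsValley asc v := fun x y z hs => h x y z (hs.trans hv)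

theorem avoidsValley_append_cons {asc : Bool} {L R : List ℕ} {a : ℕ}
    (hL : ∀ x ∈ L, a < x) (hR : ∀ x ∈ R, a < x) :
    AvoidsValley asc (L ++ a :: R) ↔
      AvoidsValley asc L ∧ AvoidsValley asc R ∧ ∀ x ∈ L, ∀ z ∈ R, ¬ OuterRel asc x z := by
  constructor
  · intro h
    refine ⟨h.sublist (sublist_append_left _ _),
      h.sublist ((sublist_cons_self a R).trans (sublist_append_right _ _)), fun x hx z hz => ?_⟩
    refine h x a z ?_ (hL x hx) (hR z hz)
    exact (singleton_sublist.2 hx).append ((singleton_sublist.2 hz).cons_cons a)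
  · rintro ⟨h1, h2, h3⟩ x y z hs hyx hyz
    obtain ⟨l1, l2, he, hs1, hs2⟩ := sublist_append_iff.1 hs
    have hz : ∀ {y z : ℕ}, [y, z] <+ a :: R → z ∈ R := by
      intro y z h
      rcases sublist_cons_iff.1 h with h | ⟨r, hr, h⟩
      · exact h.subset (by simp)
      · simp only [cons.injEq] at hr
        rw [← hr.2] at h
        exact h.subset (by simp)
    match l1, he with
    | [], he =>
      simp only [nil_append] at he
      subst he
      rcases sublist_cons_iff.1 hs2 with h | ⟨r, hr, h⟩
      · exact h2 x y z h hyx hyz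
      · simp only [cons.injEq] at hr
        rw [← hr.2] at h
        have := hR y (h.subset (by simp))
        omega
    | [b], he =>
      simp only [cons_append, nil_append, cons.injEq] at he
      obtain ⟨rfl, rfl⟩ := he
      exact h3 x (hs1.subset (by simp)) z (hz hs2)
    | [b, c], he =>
      simp only [cons_append, nil_append, cons.injEq] at he
      obtain ⟨rfl, rfl, rfl⟩ := he
      have hx : x ∈ L := hs1.subset (by simp)
      have hy := hL y (hs1.subset (by simp))
      rcases mem_cons.1 (hs2.subset (mem_singleton_self z)) with h | h
      · omega
      · exact h3 x hx z h
    | [b, c, d], he =>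
      simp only [cons_append, nil_append, cons.injEq] at he
      obtain ⟨rfl, rfl, rfl, rfl⟩ := he
      exact h1 _ _ _ hs1 hyx hyz
    | b :: c :: d :: e :: l, he => simp at he

/-- The avoiding word on the letters `a, a + 1, …` whose decreasing tree has shape `t`. -/
def treeWord (asc : Bool) : BinaryTree Unit → ℕ → List ℕ
  | .nil, _ => []
  | node _ l r, a =>
    treeWord asc l (a + 1 + if asc then r.numNodes else 0) ++
      a :: treeWord asc r (a + 1 + if asc then 0 else l.numNodes)

theorem treeWord_perm (asc : Bool) (t : BinaryTree Unit) (a : ℕ) :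
    treeWord asc t a ~ range' a t.numNodes := by
  induction t generalizing a with
  | nil => simp [treeWord, numNodes]
  | node u l r hl hr =>
    rw [treeWord, numNodes, range'_succ]
    refine perm_middle.trans (Perm.cons a ?_)
    refine ((hl _).append (hr _)).trans ?_
    cases asc
    · simp
    · refine perm_append_comm.trans ?_
      simp [add_comm l.numNodes]

theorem length_treeWord (asc : Bool) (t : BinaryTree Unit) (a : ℕ) :
    (treeWord asc t a).length = t.numNodes := by
  simpa using (treeWord_perm asc t a).length_eq

theorem mem_treeWord {asc : Bool} {t : BinaryTree Unit} {a x : ℕ} :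
    x ∈ treeWord asc t a ↔ a ≤ x ∧ x < a + t.numNodes := by
  rw [(treeWord_perm asc t a).mem_iff, mem_range'_1]

theorem treeWord_avoids (asc : Bool) (t : BinaryTree Unit) (a : ℕ) :
    AvoidsValley asc (treeWord asc t a) := by
  induction t generalizing a with
  | nil => intro x y z h; simp [treeWord] at h
  | node u l r hl hr =>
    rw [treeWord, avoidsValley_append_cons]
    · refine ⟨hl _, hr _, fun x hx z hz => ?_⟩
      rw [mem_treeWord] at hx hz
      cases asc <;> simp [OuterRel] at * <;> omega
    · intro x hx; rw [mem_treeWord] at hx; omega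
    · intro x hx; rw [mem_treeWord] at hx; omega

theorem append_cons_injective {L L' R R' : List ℕ} {a : ℕ} (hL : a ∉ L) (hL' : a ∉ L')
    (h : L ++ a :: R = L' ++ a :: R') : L = L' ∧ R = R' := by
  induction L generalizing L' with
  | nil =>
    cases L' with
    | nil => simpa using h
    | cons b L' => simp at h hL'; omega
  | cons b L ih =>
    cases L' with
    | nil => simp at h hL; omega
    | cons c L' =>
      simp only [cons_append, cons.injEq, mem_cons, not_or] at h hL hL'
      obtain ⟨h1, h2⟩ := ih hL.2 hL'.2 h.2
      exact ⟨by rw [h.1, h1], h2⟩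

theorem treeWord_injective (asc : Bool) (a : ℕ) : Function.Injective (treeWord asc · a) := by
  intro t t' h
  simp only at h
  induction t generalizing t' a with
  | nil =>
    have := congrArg length h
    cases t' <;> simp_all [treeWord]
  | node u l r hl hr =>
    cases t' with
    | nil => simp [treeWord] at h
    | node u' l' r' =>
      rw [treeWord, treeWord] at h
      obtain ⟨h1, h2⟩ := append_cons_injective (by rw [mem_treeWord]; omega)
        (by rw [mem_treeWord]; omega) h
      have e1 := congrArg length h1
      have e2 := congrArg length h2
      rw [length_treeWord, length_treeWord] at e1 e2
      rw [e2] at h1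
      rw [e1] at h2
      rw [hl _ h1, hr _ h2]

/-- If `U ++ V` uses the letters of an interval, with those of `U` below those of `V`, then `U`
and `V` each use the letters of an interval. -/
theorem perm_range'_of_append {U V : List ℕ} {a n : ℕ} (h : U ++ V ~ range' a n)
    (hlt : ∀ x ∈ U, ∀ y ∈ V, x ≤ y) :
    U ~ range' a U.length ∧ V ~ range' (a + U.length) V.length := by
  have hlen : n = U.length + V.length := by simpa using h.length_eq.symm
  have hs : ∀ l : List ℕ, (l.mergeSort (· ≤ ·)).Pairwise (· ≤ ·) := fun l => by
    simpa using pairwise_mergeSort (le := fun a b : ℕ => decide (a ≤ b))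
      (fun a b c => by simp only [decide_eq_true_eq]; exact le_trans)
      (fun a b => by simpa using le_total a b) l
  have hU := mergeSort_perm U (· ≤ ·)
  have hV := mergeSort_perm V (· ≤ ·)
  have key : U.mergeSort (· ≤ ·) ++ V.mergeSort (· ≤ ·) =
      range' a U.length ++ range' (a + U.length) V.length := by
    refine Perm.eq_of_pairwise' (r := (· ≤ ·)) ?_ ?_ ?_
    · rw [pairwise_append]
      exact ⟨hs U, hs V, fun x hx y hy => hlt x (hU.mem_iff.1 hx) y (hV.mem_iff.1 hy)⟩
    · rw [range'_append_1]
      exact Pairwise.imp le_of_lt pairwise_lt_range'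
    · rw [range'_append_1, ← hlen]
      exact (hU.append hV).trans h
  obtain ⟨h1, h2⟩ := append_inj key (by simp)
  exact ⟨h1 ▸ hU.symm, h2 ▸ hV.symm⟩

theorem exists_treeWord (asc : Bool) (n : ℕ) : ∀ (a : ℕ) (w : List ℕ), w ~ range' a n →
    AvoidsValley asc w → ∃ t : BinaryTree Unit, treeWord asc t a = w := by
  induction n using Nat.strong_induction_on with
  | _ n ih =>
    intro a w hw hav
    cases n with
    | zero => exact ⟨.nil, by simpa [treeWord, eq_comm] using hw⟩
    | succ n =>
      have ha : a ∈ w := by simp [hw.mem_iff]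
      obtain ⟨L, R, rfl⟩ := append_of_mem ha
      have hLR : L ++ R ~ range' (a + 1) n := by
        rw [range'_succ] at hw
        exact (perm_middle.symm.trans hw).cons_inv
      have hmem : ∀ x, x ∈ L ∨ x ∈ R → a < x := fun x hx => by
        have := hLR.mem_iff.1 (mem_append.2 hx)
        rw [mem_range'_1] at this
        omega
      obtain ⟨h1, h2, h3⟩ := (avoidsValley_append_cons (fun x hx => hmem x (.inl hx))
        (fun x hx => hmem x (.inr hx))).1 hav
      have hlen : L.length + R.length = n := by simpa using hLR.length_eq
      cases asc
      · obtain ⟨p1, p2⟩ := perm_range'_of_append hLR (by simpa [OuterRel] using h3)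
        obtain ⟨l, hl⟩ := ih _ (by omega) _ _ p1 h1
        obtain ⟨r, hr⟩ := ih _ (by omega) _ _ p2 h2
        have := congrArg length hl
        rw [length_treeWord] at this
        exact ⟨node () l r, by simp [treeWord, hl, hr, this]⟩
      · obtain ⟨p2, p1⟩ := perm_range'_of_append (perm_append_comm.trans hLR)
          (fun x hx y hy => by simpa [OuterRel] using h3 y hy x hx)
        obtain ⟨l, hl⟩ := ih _ (by omega) _ _ p1 h1
        obtain ⟨r, hr⟩ := ih _ (by omega) _ _ p2 h2
        have := congrArg length hr
        rw [length_treeWord] at this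
        exact ⟨node () l r, by simp [treeWord, hl, hr, this]⟩

/-- The length of the initial descending run of a word. -/
def initialRun : List ℕ → ℕ
  | [] => 0
  | [_] => 1
  | x :: y :: l => if x < y then 1 else initialRun (y :: l) + 1

theorem initialRun_le_length (w : List ℕ) : initialRun w ≤ w.length := by
  fun_induction initialRun w <;> simp_all

theorem initialRun_cons_pos (x : ℕ) (w : List ℕ) : 1 ≤ initialRun (x :: w) := by
  cases w with
  | nil => simp [initialRun]
  | cons y w => rw [initialRun]; split <;> omega

theorem initialRun_append_cons {L R : List ℕ} {a : ℕ}
    (hL : ∀ x ∈ L, a < x) (hR : ∀ x ∈ R, a < x) :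
    initialRun (L ++ a :: R) =
      if initialRun L = L.length then L.length + 1 else initialRun L := by
  have h1 : initialRun (a :: R) = 1 := by
    cases R with
    | nil => simp [initialRun]
    | cons y R => simp [initialRun, hR]
  fun_induction initialRun L with
  | case1 => simpa using h1
  | case2 x =>
    have := hL x (by simp)
    simp [initialRun, h1, this.le]
  | case3 x y l hxy => simp [initialRun, hxy]
  | case4 x y l hxy ih =>
    have := ih fun z hz => hL z (mem_cons_of_mem _ hz)
    simp only [cons_append, initialRun, hxy, if_false, length_cons] at this ⊢
    rw [this]
    split_ifs <;> omega

/-- The length of the initial descending run of the word of a tree. -/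
def treeRun : BinaryTree Unit → ℕ
  | .nil => 0
  | node _ l _ => if treeRun l = l.numNodes then l.numNodes + 1 else treeRun l

theorem initialRun_treeWord (asc : Bool) (t : BinaryTree Unit) (a : ℕ) :
    initialRun (treeWord asc t a) = treeRun t := by
  induction t generalizing a with
  | nil => rfl
  | node u l r hl hr =>
    rw [treeWord, initialRun_append_cons, hl, length_treeWord, treeRun] <;>
    · intro x hx; rw [mem_treeWord] at hx; omega

theorem initialRun_spec (w : List ℕ) {i : ℕ} (hi : i + 1 < w.length) :
    (i + 1 < initialRun w → w[i + 1] ≤ w[i]) ∧ (i + 1 = initialRun w → w[i] < w[i + 1]) := by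
  fun_induction initialRun w generalizing i with
  | case1 => simp at hi
  | case2 => simp at hi
  | case3 x y l hxy =>
    refine ⟨by omega, fun h => ?_⟩
    obtain rfl : i = 0 := by omega
    simpa
  | case4 x y l hxy ih =>
    cases i with
    | zero =>
      have := initialRun_cons_pos y l
      exact ⟨fun _ => by simpa using hxy, by omega⟩
    | succ i =>
      have := ih (i := i) (by simpa using hi)
      simpa using this

theorem initialRun_pos {w : List ℕ} (h : w ≠ []) : 1 ≤ initialRun w := by
  cases w with
  | nil => exact absurd rfl h
  | cons x w => exact initialRun_cons_pos x w

/-- The one-line notation of a permutation as a word. -/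
def permWord {n : ℕ} (π : Equiv.Perm (Fin n)) : List ℕ := ofFn fun i => (π i : ℕ)

theorem permWord_injective (n : ℕ) : Function.Injective (permWord (n := n)) := by
  intro π ρ h
  ext i
  exact congrFun (ofFn_injective h) i

theorem permWord_perm {n : ℕ} (π : Equiv.Perm (Fin n)) : permWord π ~ range' 0 n := by
  rw [perm_ext_iff_of_nodup]
  · intro x
    simp only [permWord, mem_ofFn, mem_range'_1]
    constructor
    · rintro ⟨i, rfl⟩
      simp
    · intro hx
      exact ⟨π.symm ⟨x, by omega⟩, by simp⟩
  · exact nodup_ofFn.2 fun i j h => π.injective (Fin.ext h)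
  · exact nodup_range'

theorem exists_permWord {n : ℕ} {w : List ℕ} (h : w ~ range' 0 n) :
    ∃ π : Equiv.Perm (Fin n), permWord π = w := by
  have hlen : w.length = n := by simpa using h.length_eq
  subst hlen
  have hlt : ∀ i : Fin w.length, w.get i < w.length := fun i => by
    have := h.mem_iff.1 (get_mem w i)
    rw [mem_range'_1] at this
    omega
  have hinj : Function.Injective fun i : Fin w.length => (⟨w.get i, hlt i⟩ : Fin w.length) :=
    fun i j hij => (h.nodup_iff.2 nodup_range').injective_get (Fin.mk.inj hij)
  refine ⟨Equiv.ofBijective _ (Finite.injective_iff_bijective.1 hinj), ?_⟩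
  simp only [permWord, Equiv.ofBijective_apply]
  exact ofFn_get w

theorem isDesarrangement_iff {n : ℕ} (π : Equiv.Perm (Fin n)) :
    IsDesarrangement n π ↔ Even (initialRun (permWord π)) := by
  have hlen : (permWord π).length = n := by simp [permWord]
  rcases Nat.eq_zero_or_pos n with rfl | hn
  · simp [IsDesarrangement, permWord, initialRun]
  have hle := initialRun_le_length (permWord π)
  have hpos : 1 ≤ initialRun (permWord π) := initialRun_pos (ne_nil_of_length_pos (by omega))
  have spec := fun i => initialRun_spec (permWord π) (i := i)
  obtain ⟨k, hk⟩ : ∃ k, initialRun (permWord π) = k + 1 := ⟨_, (Nat.sub_add_cancel hpos).symm⟩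
  rw [hk] at hle spec ⊢
  have hasc : IsAscent n π (k + 1) := by
    refine ⟨by omega, by omega, ?_⟩
    rcases Nat.lt_or_ge (k + 1) n with h | h
    · have := (spec k (by omega)).2 rfl
      simp only [permWord, List.getElem_ofFn, Fin.val_fin_lt] at this
      exact .inr ⟨h, this⟩
    · left; omega
  have hmin : ∀ j, IsAscent n π j → k + 1 ≤ j := by
    rintro j ⟨hj1, hj2, hj⟩
    by_contra! hlt
    rcases hj with rfl | ⟨h, hj⟩
    · omega
    obtain ⟨i, rfl⟩ : ∃ i, j = i + 1 := ⟨j - 1, by omega⟩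
    have := (spec i (by omega)).1 hlt
    simp only [permWord, List.getElem_ofFn, Fin.val_fin_le] at this
    exact absurd hj (not_lt.2 this)
  constructor
  · rintro (h | ⟨i, hi, he, hm⟩)
    · omega
    · rwa [le_antisymm (hmin i hi) (hm _ hasc)]
  · exact fun h => .inr ⟨_, hasc, h, hmin⟩

/-- The pattern `213` for `true` and `312` for `false`. -/
def valleyPattern (asc : Bool) : Fin 3 → Fin 3 := if asc then ![1, 0, 2] else ![2, 0, 1]

theorem not_containsPattern_iff (asc : Bool) {n : ℕ} (π : Equiv.Perm (Fin n)) :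
    ¬ ContainsPattern (valleyPattern asc) π ↔ AvoidsValley asc (permWord π) := by
  have hsub : ∀ x y z, [x, y, z] <+ permWord π ↔ ∃ f : Fin 3 ↪o Fin n,
      x = π (f 0) ∧ y = π (f 1) ∧ z = π (f 2) := by
    intro x y z
    rw [sublist_iff_exists_fin_orderEmbedding_get_eq]
    have hlen : (permWord π).length = n := by simp [permWord]
    constructor
    · rintro ⟨f, hf⟩
      refine ⟨f.trans (Fin.castOrderIso hlen).toOrderEmbedding, ?_⟩
      have h0 := hf 0
      have h1 := hf 1
      have h2 := hf 2
      simp only [permWord, get_ofFn] at h0 h1 h2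
      exact ⟨h0, h1, h2⟩
    · rintro ⟨f, h0, h1, h2⟩
      refine ⟨f.trans (Fin.castOrderIso hlen.symm).toOrderEmbedding, fun i => ?_⟩
      simp only [permWord, get_ofFn]
      change Fin 3 at i
      fin_cases i
      · exact h0
      · exact h1
      · exact h2
  rw [ContainsPattern, AvoidsValley]
  simp only [hsub]
  constructor
  · rintro h x y z ⟨f, rfl, rfl, rfl⟩ h1 h2 h3
    refine h ⟨f, ?_⟩
    simp only [Fin.lt_def]
    intro i j
    cases asc <;> fin_cases i <;> fin_cases j <;>
      simp [OuterRel, valleyPattern] at * <;> omega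
  · rintro h ⟨f, hf⟩
    refine h _ _ _ ⟨f, rfl, rfl, rfl⟩ ?_ ?_ ?_
    · exact (hf 1 0).2 (by cases asc <;> decide)
    · exact (hf 1 2).2 (by cases asc <;> decide)
    · cases asc
      · exact (hf 2 0).2 (by decide)
      · exact (hf 0 2).2 (by decide)

theorem dcount_eq_card_trees (asc : Bool) (n : ℕ) :
    dcount n {valleyPattern asc} =
      ((treesOfNumNodesEq n).filter fun t => Even (treeRun t)).card := by
  rw [dcount, ← Finset.card_image_of_injective _ (permWord_injective n),
    ← Finset.card_image_of_injective _ (treeWord_injective asc 0)]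
  congr 1
  ext w
  simp only [Finset.mem_image, Finset.mem_filter, Finset.mem_univ, true_and,
    Finset.mem_singleton, forall_eq, not_containsPattern_iff, isDesarrangement_iff,
    mem_treesOfNumNodesEq]
  constructor
  · rintro ⟨π, ⟨hd, hav⟩, rfl⟩
    obtain ⟨t, ht⟩ := exists_treeWord asc n 0 _ (permWord_perm π) hav
    refine ⟨t, ⟨?_, ?_⟩, ht⟩
    · rw [← length_treeWord asc t 0, ht]
      simp [permWord]
    · rwa [← initialRun_treeWord asc t 0, ht]
  · rintro ⟨t, ⟨rfl, he⟩, rfl⟩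
    obtain ⟨π, hπ⟩ := exists_permWord (treeWord_perm asc t 0)
    refine ⟨π, ?_, hπ⟩
    rw [hπ, initialRun_treeWord]
    exact ⟨he, treeWord_avoids asc t 0⟩

theorem sum_treesOfNumNodesEq_succ (n : ℕ) (f : BinaryTree Unit → ℤ) :
    ∑ t ∈ treesOfNumNodesEq (n + 1), f t =
      ∑ ij ∈ Finset.HasAntidiagonal.antidiagonal n, ∑ l ∈ treesOfNumNodesEq ij.1,
        ∑ r ∈ treesOfNumNodesEq ij.2, f (node () l r) := by
  rw [treesOfNumNodesEq_succ, Finset.sum_biUnion]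
  · refine Finset.sum_congr rfl fun ij _ => ?_
    rw [Finset.sum_map, Finset.sum_product]
    rfl
  · simp_rw [Set.PairwiseDisjoint, Set.Pairwise, Finset.disjoint_left]
    aesop

theorem treeRun_le (t : BinaryTree Unit) : treeRun t ≤ t.numNodes := by
  simpa [initialRun_treeWord, length_treeWord] using initialRun_le_length (treeWord true t 0)

theorem sum_treeRun_eq_numNodes (n : ℕ) :
    ∑ t ∈ treesOfNumNodesEq n, (if treeRun t = n then 1 else 0 : ℤ) = 1 := by
  induction n with
  | zero =>
    rw [treesOfNumNodesEq_zero, Finset.sum_singleton, treeRun, if_pos rfl]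
  | succ n ih =>
    rw [sum_treesOfNumNodesEq_succ, Finset.sum_eq_single (n, 0)]
    · rw [← ih]
      refine Finset.sum_congr rfl fun l hl => ?_
      rw [mem_treesOfNumNodesEq] at hl
      have := treeRun_le l
      simp only [treesOfNumNodesEq_zero, Finset.sum_singleton, treeRun, hl] at this ⊢
      split_ifs <;> first | rfl | omega
    · rintro ⟨i, j⟩ hij hne
      rw [Finset.HasAntidiagonal.mem_antidiagonal] at hij
      refine Finset.sum_eq_zero fun l hl => Finset.sum_eq_zero fun r hr => if_neg ?_
      rw [mem_treesOfNumNodesEq] at hl hr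
      have := treeRun_le l
      have hi : i ≠ n := by
        rintro rfl
        exact hne (by simp at hij ⊢; omega)
      simp only at hij hl hr
      rw [treeRun]
      split_ifs <;> omega
    · simp

/-- The number of trees with `n` nodes and even initial run. -/
def evenRunCount (n : ℕ) : ℤ :=
  ∑ t ∈ treesOfNumNodesEq n, if Even (treeRun t) then 1 else 0

theorem evenRunCount_succ (n : ℕ) :
    evenRunCount (n + 1) = ∑ ij ∈ Finset.HasAntidiagonal.antidiagonal n,
      (evenRunCount ij.1 - (-1) ^ ij.1) * catalan ij.2 := by
  rw [evenRunCount, sum_treesOfNumNodesEq_succ]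
  refine Finset.sum_congr rfl fun ij _ => ?_
  obtain ⟨i, j⟩ := ij
  have key : evenRunCount i - (-1) ^ i = ∑ l ∈ treesOfNumNodesEq i,
      ((if Even (treeRun l) then 1 else 0) - (if treeRun l = i then 1 else 0) * (-1) ^ i : ℤ) := by
    rw [Finset.sum_sub_distrib, ← Finset.sum_mul, sum_treeRun_eq_numNodes, one_mul, evenRunCount]
  simp only [key, Finset.sum_mul]
  refine Finset.sum_congr rfl fun l hl => ?_
  rw [mem_treesOfNumNodesEq] at hl
  rw [← treesOfNumNodesEq_card_eq_catalan j, mul_comm, ← nsmul_eq_mul, ← Finset.sum_const]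
  refine Finset.sum_congr rfl fun r _ => ?_
  rw [treeRun, hl]
  by_cases h : treeRun l = i
  · rcases Nat.even_or_odd i with he | ho
    · simp [h, he, Nat.even_add_one]
    · simp [h, Nat.not_even_iff_odd.2 ho, Nat.even_add_one, ho.neg_one_pow]
  · simp [h]

theorem convolution_catalan (a : ℕ → ℤ) (ha0 : a 0 = 1)
    (ha : ∀ m : ℕ, a (m + 1) = (catalan m : ℤ) - a m) (n : ℕ) :
    a (n + 1) = ∑ ij ∈ Finset.HasAntidiagonal.antidiagonal n, (a ij.1 - (-1) ^ ij.1) * catalan ij.2 := by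
  induction n with
  | zero => simp [ha, ha0]
  | succ n ih =>
    rw [ha, ih, Finset.Nat.sum_antidiagonal_succ, catalan_succ', sub_eq_iff_eq_add]
    simp only [ha0, pow_zero, sub_self, zero_mul, zero_add, Nat.cast_sum, Nat.cast_mul]
    rw [← Finset.sum_add_distrib]
    refine Finset.sum_congr rfl fun ij _ => ?_
    rw [ha, pow_succ]
    ring

theorem evenRunCount_eq (a : ℕ → ℤ) (ha0 : a 0 = 1)
    (ha : ∀ m : ℕ, a (m + 1) = (catalan m : ℤ) - a m) (n : ℕ) : evenRunCount n = a n := by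
  induction n using Nat.strong_induction_on with
  | _ n ih =>
    cases n with
    | zero =>
      rw [evenRunCount, treesOfNumNodesEq_zero, Finset.sum_singleton, treeRun, ha0]
      simp
    | succ n =>
      rw [evenRunCount_succ, convolution_catalan a ha0 ha]
      refine Finset.sum_congr rfl fun ij hij => ?_
      rw [Finset.HasAntidiagonal.mem_antidiagonal] at hij
      rw [ih ij.1 (by omega)]

theorem cast_dcount_valleyPattern (asc : Bool) (n : ℕ) :
    (dcount n {valleyPattern asc} : ℤ) = evenRunCount n := by
  rw [dcount_eq_card_trees, evenRunCount, Finset.card_filter]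
  push_cast
  rfl

/-- Let `a₀ = 1` and `a_(n+1) = C_n − a_n`. Then for every `n ≥ 0` and each
`σ ∈ {213, 312}`, the number of desarrangements of length `n` avoiding `σ` equals `a_n`. -/
theorem desarrangements_avoiding_213_or_312 (a : ℕ → ℤ)
    (ha0 : a 0 = 1) (ha : ∀ m : ℕ, a (m + 1) = (catalan m : ℤ) - a m)
    (n : ℕ) (σ : Fin 3 → Fin 3)
    (hσ : σ = ![1,0,2] ∨ σ = ![2,0,1]) :
    (dcount n {σ} : ℤ) = a n := by
  rw [← evenRunCount_eq a ha0 ha n]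
  rcases hσ with rfl | rfl
  · exact cast_dcount_valleyPattern true n
  · exact cast_dcount_valleyPattern false n
end

section
/- For every integer n ≥ 0, C_n = d_n({213}) + d_{n+1}({213}), where C_n is the n-th Catalan number and d_n({213}) is the number of desarrangements of length n avoiding the pattern 213. -/
open scoped Classical

/-- A list avoids the pattern `213`: no letter is followed by a smaller and then a larger one. -/
def Avoids213 : List ℕ → Prop
  | [] => True
  | a :: l => l.Pairwise (fun x y => ¬ (x < a ∧ a < y)) ∧ Avoids213 l

lemma avoids213_iff (l : List ℕ) :
    Avoids213 l ↔ ∀ i j k (hij : i < j) (hjk : j < k) (hk : k < l.length),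
      ¬ (l[j] < l[i] ∧ l[i] < l[k]) := by
  induction l with
  | nil => simp [Avoids213]
  | cons a l ih =>
    rw [Avoids213, ih, List.pairwise_iff_getElem]
    constructor
    · rintro ⟨h₁, h₂⟩ i j k hij hjk hk
      obtain ⟨j, rfl⟩ : ∃ j', j = j' + 1 := ⟨j - 1, by omega⟩
      obtain ⟨k, rfl⟩ : ∃ k', k = k' + 1 := ⟨k - 1, by omega⟩
      simp only [List.length_cons] at hk
      cases i with
      | zero => exact h₁ j k (by omega) (by omega) (by omega)
      | succ i => exact h₂ i j k (by omega) (by omega) (by omega)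
    · intro h
      refine ⟨fun j k hj hk hjk => ?_, fun i j k hij hjk hk => ?_⟩
      · exact h 0 (j + 1) (k + 1) (by omega) (by omega) (by simpa using hk)
      · exact h (i + 1) (j + 1) (k + 1) (by omega) (by omega) (by simpa using hk)

lemma Avoids213.filter {l : List ℕ} (h : Avoids213 l) (p : ℕ → Bool) :
    Avoids213 (l.filter p) := by
  induction l with
  | nil => simp [Avoids213]
  | cons a l ih =>
    rw [List.filter_cons]
    split_ifs
    · exact ⟨h.1.filter p, ih h.2⟩
    · exact ih h.2

lemma Avoids213.append {l₁ l₂ : List ℕ} (h₁ : Avoids213 l₁) (h₂ : Avoids213 l₂)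
    (h : ∀ x ∈ l₁, ∀ y ∈ l₂, y < x) : Avoids213 (l₁ ++ l₂) := by
  induction l₁ with
  | nil => simpa using h₂
  | cons a l ih =>
    refine ⟨List.pairwise_append.2 ⟨h₁.1, ?_, ?_⟩, ih h₁.2 fun x hx => h x (by simp [hx])⟩
    · refine List.pairwise_of_forall_mem_list fun x _ y hy hxy => ?_
      have := h a (by simp) y hy
      omega
    · intro x _ y hy hxy
      have := h a (by simp) y hy
      omega

lemma eq_filter_append_filter {a : ℕ} {l : List ℕ} (ha : a ∉ l)
    (h : l.Pairwise (fun x y => ¬ (x < a ∧ a < y))) :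
    l.filter (a < ·) ++ l.filter (· < a) = l := by
  induction l with
  | nil => simp
  | cons b l ih =>
    simp only [List.mem_cons, not_or] at ha
    rw [List.pairwise_cons] at h
    rcases lt_or_gt_of_ne ha.1 with hb | hb
    · have hb' : ¬ b < a := by omega
      simpa [List.filter_cons, hb, hb'] using ih ha.2 h.2
    · have hb' : ¬ a < b := by omega
      have hl : ∀ y ∈ l, y < a := fun y hy => by
        have := h.1 y hy
        have : a ≠ y := fun e => ha.2 (e ▸ hy)
        omega
      have e₁ : l.filter (a < ·) = [] := by
        rw [List.filter_eq_nil_iff]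
        intro y hy
        have := hl y hy
        simp only [decide_eq_true_eq]
        omega
      have e₂ : l.filter (· < a) = l := by
        rw [List.filter_eq_self]
        intro y hy
        simpa using hl y hy
      simp [hb, hb', e₁, e₂]

/-- The `213`-avoiding arrangement of `o, o + 1, …, o + t.numNodes - 1` encoded by `t`: the root
is the first letter, the left subtree encodes the larger letters, which come next, and the
right subtree encodes the smaller ones. -/
def treeList : BinaryTree Unit → ℕ → List ℕ
  | .nil, _ => []
  | .node _ l r, o => (o + r.numNodes) :: (treeList l (o + r.numNodes + 1) ++ treeList r o)

lemma length_treeList (t : BinaryTree Unit) (o : ℕ) : (treeList t o).length = t.numNodes := by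
  induction t generalizing o with
  | nil => rfl
  | node _ l r ihl ihr => simp [treeList, BinaryTree.numNodes, ihl, ihr]

lemma mem_treeList (t : BinaryTree Unit) (o x : ℕ) :
    x ∈ treeList t o ↔ o ≤ x ∧ x < o + t.numNodes := by
  induction t generalizing o with
  | nil => simp [treeList, BinaryTree.numNodes]
  | node _ l r ihl ihr =>
    simp only [treeList, BinaryTree.numNodes, List.mem_cons, List.mem_append, ihl, ihr]
    omega

lemma nodup_treeList (t : BinaryTree Unit) (o : ℕ) : (treeList t o).Nodup := by
  induction t generalizing o with
  | nil => simp [treeList]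
  | node _ l r ihl ihr =>
    simp only [treeList, List.nodup_cons, List.mem_append, mem_treeList]
    refine ⟨by omega, List.nodup_append.2 ⟨ihl _, ihr _, ?_⟩⟩
    intro x hx y hy
    rw [mem_treeList] at hx hy
    omega

lemma avoids213_treeList (t : BinaryTree Unit) (o : ℕ) : Avoids213 (treeList t o) := by
  induction t generalizing o with
  | nil => simp [treeList, Avoids213]
  | node _ l r ihl ihr =>
    refine ⟨List.pairwise_append.2 ⟨?_, ?_, ?_⟩, (ihl _).append (ihr _) ?_⟩
    · refine List.pairwise_of_forall_mem_list fun x hx y _ => ?_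
      rw [mem_treeList] at hx
      omega
    · refine List.pairwise_of_forall_mem_list fun x _ y hy => ?_
      rw [mem_treeList] at hy
      omega
    all_goals
      intro x hx y hy
      rw [mem_treeList] at hx hy
      omega

lemma treeList_injective (o : ℕ) : Function.Injective (treeList · o) := by
  intro t t' h
  induction t generalizing o t' with
  | nil =>
    cases t' with
    | nil => rfl
    | node _ l r => simp [treeList] at h
  | node _ l r ihl ihr =>
    cases t' with
    | nil => simp [treeList] at h
    | node _ l' r' =>
      have hlen := congrArg List.length h
      simp only [length_treeList, BinaryTree.numNodes] at hlen
      simp only [treeList, List.cons.injEq, Nat.add_left_cancel_iff] at h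
      obtain ⟨hr, h⟩ := h
      obtain ⟨h₁, h₂⟩ := List.append_inj h (by simp only [length_treeList]; omega)
      rw [← hr] at h₁
      rw [ihl _ h₁, ihr _ h₂]

lemma exists_treeList_eq (n o : ℕ) (l : List ℕ) (hd : l.Nodup)
    (hm : ∀ x, x ∈ l ↔ o ≤ x ∧ x < o + n) (ha : Avoids213 l) :
    ∃ t : BinaryTree Unit, t.numNodes = n ∧ treeList t o = l := by
  induction n using Nat.strong_induction_on generalizing o l with
  | _ n ih =>
  cases l with
  | nil =>
    refine ⟨.nil, ?_, rfl⟩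
    have := hm o
    simp at this
    simp [BinaryTree.numNodes, this]
  | cons a l =>
    obtain ⟨h₁, h₂⟩ := (hm a).1 (by simp)
    obtain ⟨k, rfl⟩ := Nat.exists_eq_add_of_le h₁
    obtain ⟨m, rfl⟩ : ∃ m, n = m + k + 1 := ⟨n - k - 1, by omega⟩
    rw [List.nodup_cons] at hd
    have hl : ∀ x, x ∈ l ↔ (o ≤ x ∧ x < o + (m + k + 1)) ∧ x ≠ o + k := fun x => by
      rw [← hm x, List.mem_cons]
      constructor
      · exact fun hx => ⟨.inr hx, fun e => hd.1 (e ▸ hx)⟩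
      · rintro ⟨hx | hx, hne⟩
        · exact absurd hx hne
        · exact hx
    obtain ⟨t₁, hn₁, ht₁⟩ := ih m (by omega) (o + k + 1) (l.filter (o + k < ·)) (hd.2.filter _)
      (fun x => by simp only [List.mem_filter, hl, decide_eq_true_eq]; omega) (ha.2.filter _)
    obtain ⟨t₂, hn₂, ht₂⟩ := ih k (by omega) o (l.filter (· < o + k)) (hd.2.filter _)
      (fun x => by simp only [List.mem_filter, hl, decide_eq_true_eq]; omega) (ha.2.filter _)
    refine ⟨.node () t₁ t₂, by simp [BinaryTree.numNodes, hn₁, hn₂], ?_⟩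
    rw [treeList, hn₂, ht₁, ht₂, eq_filter_append_filter hd.1 ha.1]

lemma not_containsPattern_213_iff {n : ℕ} (π : Equiv.Perm (Fin n)) :
    ¬ ContainsPattern ![1, 0, 2] π ↔
      ∀ i j k, i < j → j < k → ¬ (π j < π i ∧ π i < π k) := by
  rw [← not_iff_not, not_not]
  push Not
  constructor
  · rintro ⟨f, hf⟩
    exact ⟨f 0, f 1, f 2, f.strictMono (by decide), f.strictMono (by decide),
      (hf 1 0).2 (by decide), (hf 0 2).2 (by decide)⟩
  · rintro ⟨i, j, k, hij, hjk, h₁, h₂⟩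
    have hmono : StrictMono ![i, j, k] := by
      intro a b hab
      have hik := hij.trans hjk
      fin_cases a <;> fin_cases b <;> simp_all
    have h₃ := h₁.trans h₂
    refine ⟨OrderEmbedding.ofStrictMono _ hmono, fun a b => ?_⟩
    rw [OrderEmbedding.coe_ofStrictMono]
    fin_cases a <;> fin_cases b <;> simp [h₁, h₂, h₃, h₁.le, h₂.le, h₃.le]

/-- The one-line notation of a permutation, as a list. -/
def oneLine {n : ℕ} (π : Equiv.Perm (Fin n)) : List ℕ := List.ofFn fun i => (π i : ℕ)

lemma oneLine_injective (n : ℕ) : Function.Injective (oneLine (n := n)) := by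
  intro π σ h
  ext i
  exact congrFun (List.ofFn_injective h) i

lemma avoids213_oneLine {n : ℕ} (π : Equiv.Perm (Fin n)) :
    Avoids213 (oneLine π) ↔ ¬ ContainsPattern ![1, 0, 2] π := by
  rw [avoids213_iff, not_containsPattern_213_iff]
  simp only [oneLine, List.length_ofFn, List.getElem_ofFn, Fin.val_fin_lt]
  constructor
  · intro h i j k hij hjk
    exact h i j k hij hjk k.2
  · intro h i j k hij hjk hk
    exact h ⟨i, by omega⟩ ⟨j, by omega⟩ ⟨k, hk⟩ hij hjk

lemma nodup_oneLine {n : ℕ} (π : Equiv.Perm (Fin n)) : (oneLine π).Nodup :=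
  List.nodup_ofFn.2 (Fin.val_injective.comp π.injective)

lemma mem_oneLine {n : ℕ} (π : Equiv.Perm (Fin n)) (x : ℕ) : x ∈ oneLine π ↔ x < n := by
  rw [oneLine, List.mem_ofFn]
  constructor
  · rintro ⟨i, rfl⟩
    exact (π i).2
  · intro hx
    exact ⟨π.symm ⟨x, hx⟩, by simp⟩

lemma exists_oneLine_eq {n : ℕ} (l : List ℕ) (hd : l.Nodup) (hm : ∀ x ∈ l, x < n)
    (hlen : l.length = n) : ∃ π : Equiv.Perm (Fin n), oneLine π = l := by
  subst hlen
  have hinj : Function.Injective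
      (fun i : Fin l.length => (⟨l[i], hm _ (List.getElem_mem _)⟩ : Fin l.length)) := by
    intro i j hij
    simp only [Fin.mk.injEq] at hij
    exact Fin.ext ((hd.getElem_inj_iff).1 hij)
  refine ⟨Equiv.ofBijective _ (Finite.injective_iff_bijective.1 hinj), ?_⟩
  exact List.ofFn_getElem

lemma card_avoiding_213 (n : ℕ) :
    (Finset.univ.filter fun π : Equiv.Perm (Fin n) => ¬ ContainsPattern ![1, 0, 2] π).card =
      catalan n := by
  rw [← BinaryTree.treesOfNumNodesEq_card_eq_catalan,
    ← Finset.card_image_of_injective _ (oneLine_injective n),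
    ← Finset.card_image_of_injective _ (treeList_injective 0)]
  congr 1
  ext l
  simp only [Finset.mem_image, Finset.mem_filter, Finset.mem_univ, true_and,
    BinaryTree.mem_treesOfNumNodesEq]
  constructor
  · rintro ⟨π, hπ, rfl⟩
    exact exists_treeList_eq n 0 _ (nodup_oneLine π) (fun x => by simp [mem_oneLine])
      ((avoids213_oneLine π).2 hπ)
  · rintro ⟨t, rfl, rfl⟩
    obtain ⟨π, hπ⟩ := exists_oneLine_eq (treeList t 0) (nodup_treeList t 0)
      (fun x hx => by simpa using ((mem_treeList t 0 x).1 hx).2) (length_treeList t 0)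
    exact ⟨π, (avoids213_oneLine π).1 (hπ ▸ avoids213_treeList t 0), hπ⟩

lemma isDesarrangement_iff_even {n i : ℕ} {π : Equiv.Perm (Fin n)} (hi : IsAscent n π i)
    (hmin : ∀ j, IsAscent n π j → i ≤ j) : IsDesarrangement n π ↔ Even i := by
  constructor
  · rintro (rfl | ⟨j, hj, hev, hj'⟩)
    · have := hi.1
      have := hi.2.1
      omega
    · rwa [le_antisymm (hmin j hj) (hj' i hi)]
  · exact fun h => .inr ⟨i, hi, h, hmin⟩

lemma exists_first_ascent {n : ℕ} (hn : 1 ≤ n) (π : Equiv.Perm (Fin n)) :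
    ∃ i, IsAscent n π i ∧ ∀ j, IsAscent n π j → i ≤ j :=
  have h : ∃ i, IsAscent n π i := ⟨n, hn, le_rfl, .inl rfl⟩
  ⟨Nat.find h, Nat.find_spec h, fun _ hj => Nat.find_min' h hj⟩

/-- Prepend a new largest letter to a permutation. -/
noncomputable def prependMax {n : ℕ} (π : Equiv.Perm (Fin n)) : Equiv.Perm (Fin (n + 1)) :=
  Equiv.ofBijective (Fin.cons (Fin.last n) fun i => (π i).castSucc) <|
    Finite.injective_iff_bijective.1 <| Fin.cons_injective_iff.2
      ⟨by rintro ⟨i, hi⟩; exact (π i).castSucc_lt_last.ne hi,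
        (Fin.castSucc_injective n).comp π.injective⟩

lemma prependMax_zero {n : ℕ} (π : Equiv.Perm (Fin n)) : prependMax π 0 = Fin.last n := rfl

lemma prependMax_succ {n : ℕ} (π : Equiv.Perm (Fin n)) (i : Fin n) :
    prependMax π i.succ = (π i).castSucc := rfl

lemma prependMax_injective (n : ℕ) : Function.Injective (prependMax (n := n)) := by
  intro π σ h
  refine Equiv.ext fun i => Fin.castSucc_injective n ?_
  rw [← prependMax_succ, h, prependMax_succ]

lemma exists_prependMax_eq {n : ℕ} (σ : Equiv.Perm (Fin (n + 1))) (h : σ 0 = Fin.last n) :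
    ∃ π, prependMax π = σ := by
  have hne : ∀ i : Fin n, σ i.succ ≠ Fin.last n := fun i hi =>
    Fin.succ_ne_zero i (σ.injective (hi.trans h.symm))
  have hinj : Function.Injective fun i : Fin n => (σ i.succ).castPred (hne i) := by
    intro i j hij
    exact Fin.succ_injective n (σ.injective (Fin.castPred_inj.1 hij))
  refine ⟨Equiv.ofBijective _ (Finite.injective_iff_bijective.1 hinj), Equiv.ext fun i => ?_⟩
  cases i using Fin.cases with
  | zero => rw [prependMax_zero, h]
  | succ i => rw [prependMax_succ]; simp

lemma containsPattern_213_prependMax {n : ℕ} (π : Equiv.Perm (Fin n)) :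
    ContainsPattern ![1, 0, 2] (prependMax π) ↔ ContainsPattern ![1, 0, 2] π := by
  rw [← not_iff_not, not_containsPattern_213_iff, not_containsPattern_213_iff]
  constructor
  · intro h i j k hij hjk
    simpa [prependMax_succ] using
      h i.succ j.succ k.succ (Fin.succ_lt_succ_iff.2 hij) (Fin.succ_lt_succ_iff.2 hjk)
  · intro h i j k hij hjk
    obtain ⟨j, rfl⟩ := Fin.exists_succ_eq.2 (Fin.ne_zero_of_lt hij)
    obtain ⟨k, rfl⟩ := Fin.exists_succ_eq.2 (Fin.ne_zero_of_lt hjk)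
    cases i using Fin.cases with
    | zero =>
      rw [prependMax_zero]
      exact fun hh => (Fin.le_last _).not_gt hh.2
    | succ i =>
      simpa [prependMax_succ] using
        h i j k (Fin.succ_lt_succ_iff.1 hij) (Fin.succ_lt_succ_iff.1 hjk)

lemma isAscent_prependMax {n : ℕ} (hn : 1 ≤ n) (π : Equiv.Perm (Fin n)) (j : ℕ) :
    IsAscent (n + 1) (prependMax π) (j + 1) ↔ IsAscent n π j := by
  cases j with
  | zero =>
    refine iff_of_false ?_ fun h => absurd h.1 (by omega)
    rintro ⟨-, -, h | ⟨h, hlt⟩⟩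
    · omega
    · exact (Fin.le_last _).not_gt hlt
  | succ k =>
    have key : (∃ h : k + 1 + 1 < n + 1, prependMax π ⟨k + 1 + 1 - 1, by omega⟩ <
        prependMax π ⟨k + 1 + 1, h⟩) ↔ ∃ h : k + 1 < n, π ⟨k + 1 - 1, by omega⟩ < π ⟨k + 1, h⟩ :=
      ⟨fun ⟨h, hlt⟩ => ⟨by omega, hlt⟩, fun ⟨h, hlt⟩ => ⟨by omega, hlt⟩⟩
    unfold IsAscent
    rw [key]
    simp

lemma isDesarrangement_prependMax {n : ℕ} (hn : 1 ≤ n) (π : Equiv.Perm (Fin n)) :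
    IsDesarrangement (n + 1) (prependMax π) ↔ ¬ IsDesarrangement n π := by
  obtain ⟨i, hi, hmin⟩ := exists_first_ascent hn π
  rw [isDesarrangement_iff_even hi hmin,
    isDesarrangement_iff_even ((isAscent_prependMax hn π i).2 hi), Nat.even_add_one]
  intro j hj
  obtain ⟨j, rfl⟩ : ∃ j', j = j' + 1 := ⟨j - 1, by have := hj.1; omega⟩
  exact Nat.succ_le_succ (hmin j ((isAscent_prependMax hn π j).1 hj))

lemma apply_zero_eq_last {n : ℕ} (hn : 1 ≤ n) {σ : Equiv.Perm (Fin (n + 1))}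
    (hd : IsDesarrangement (n + 1) σ) (ha : ¬ ContainsPattern ![1, 0, 2] σ) :
    σ 0 = Fin.last n := by
  rcases hd with h | ⟨i, hi, hev, hmin⟩
  · omega
  rw [not_containsPattern_213_iff] at ha
  have hi₂ : 2 ≤ i := by
    have := hi.1
    rcases hev with ⟨r, rfl⟩
    omega
  have h10 : σ ⟨1, by omega⟩ < σ 0 := by
    refine lt_of_le_of_ne (not_lt.1 fun hlt => ?_) (σ.injective.ne (by simp [Fin.ext_iff]))
    have := hmin 1 ⟨le_rfl, by omega, .inr ⟨by omega, hlt⟩⟩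
    omega
  by_contra hne
  have hlast : σ (σ.symm (Fin.last n)) = Fin.last n := by simp
  have h0 : σ.symm (Fin.last n) ≠ 0 := fun h => hne (by rw [← h, hlast])
  have h1 : σ.symm (Fin.last n) ≠ ⟨1, by omega⟩ := fun h => by
    rw [← h, hlast] at h10
    exact (Fin.le_last _).not_gt h10
  refine ha 0 ⟨1, by omega⟩ (σ.symm (Fin.last n)) (by simp [Fin.lt_def]) ?_
    ⟨h10, by rw [hlast]; exact lt_of_le_of_ne (Fin.le_last _) hne⟩
  simp only [ne_eq, Fin.ext_iff, Fin.val_zero] at h0 h1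
  rw [Fin.lt_def]
  simp only
  omega

lemma dcount_213 (n : ℕ) :
    dcount n {![1,0,2]} = ((Finset.univ.filter fun π : Equiv.Perm (Fin n) =>
      ¬ ContainsPattern ![1, 0, 2] π).filter fun π => IsDesarrangement n π).card := by
  rw [dcount, Finset.filter_filter]
  simp [and_comm]

lemma dcount_213_succ {n : ℕ} (hn : 1 ≤ n) :
    dcount (n + 1) {![1,0,2]} = ((Finset.univ.filter fun π : Equiv.Perm (Fin n) =>
      ¬ ContainsPattern ![1, 0, 2] π).filter fun π => ¬ IsDesarrangement n π).card := by
  rw [dcount_213, ← Finset.card_image_of_injective _ (prependMax_injective n)]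
  congr 1
  ext σ
  simp only [Finset.mem_image, Finset.mem_filter, Finset.mem_univ, true_and]
  constructor
  · rintro ⟨ha, hd⟩
    obtain ⟨π, rfl⟩ := exists_prependMax_eq σ (apply_zero_eq_last hn hd ha)
    rw [containsPattern_213_prependMax] at ha
    exact ⟨π, ⟨ha, (isDesarrangement_prependMax hn π).1 hd⟩, rfl⟩
  · rintro ⟨π, ⟨ha, hd⟩, rfl⟩
    exact ⟨by rwa [containsPattern_213_prependMax], (isDesarrangement_prependMax hn π).2 hd⟩

lemma dcount_zero_213 : dcount 0 {![1,0,2]} = 1 := by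
  rw [dcount_213, Finset.filter_true_of_mem fun π _ => .inl rfl, card_avoiding_213, catalan_zero]

lemma dcount_one_213 : dcount 1 {![1,0,2]} = 0 := by
  rw [dcount_213, Finset.card_eq_zero, Finset.filter_eq_empty_iff]
  rintro π - (h | ⟨i, hi, hev, -⟩)
  · omega
  · obtain rfl : i = 1 := le_antisymm hi.2.1 hi.1
    exact absurd hev (by decide)

/-- For every integer `n ≥ 0`, `C_n = d_n({213}) + d_(n+1)({213})`. -/
theorem catalan_eq_dcount_213_add (n : ℕ) :
    catalan n = dcount n {![1,0,2]} + dcount (n + 1) {![1,0,2]} := by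
  rcases Nat.eq_zero_or_pos n with rfl | hn
  · rw [dcount_zero_213, dcount_one_213, catalan_zero]
  · rw [dcount_213_succ hn, dcount_213, Finset.card_filter_add_card_filter_not, card_avoiding_213]
end

section
/- For every integer n ≥ 2, the number of desarrangements of length n avoiding both patterns 231 and 321 equals 2^{n−2}, i.e. d_n({231, 321}) = 2^{n−2}. -/
open scoped Classical

/-- Among any three entries of `π`, the last one exceeds at least one of the two others. -/
def LastNotMin {n : ℕ} (π : Equiv.Perm (Fin n)) : Prop :=
  ∀ i j k : Fin n, i < j → j < k → π i < π k ∨ π j < π k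

lemma containsPattern_of_triple {n : ℕ} {σ : Fin 3 → Fin 3} {π : Equiv.Perm (Fin n)}
    {i j k : Fin n} (hij : i < j) (hjk : j < k)
    (h : ∀ a b : Fin 3, π (![i, j, k] a) < π (![i, j, k] b) ↔ σ a < σ b) :
    ContainsPattern σ π := by
  have hm : StrictMono ![i, j, k] := by
    intro a b hab
    fin_cases a <;> fin_cases b <;> simp_all
    exact hij.trans hjk
  exact ⟨OrderEmbedding.ofStrictMono _ hm, h⟩

lemma avoids_iff_lastNotMin {n : ℕ} (π : Equiv.Perm (Fin n)) :
    (∀ σ ∈ ({![1,2,0], ![2,1,0]} : Finset (Fin 3 → Fin 3)), ¬ ContainsPattern σ π) ↔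
      LastNotMin π := by
  simp only [Finset.mem_insert, Finset.mem_singleton, forall_eq_or_imp, forall_eq]
  constructor
  · rintro ⟨h₁, h₂⟩ i j k hij hjk
    by_contra! hc
    obtain ⟨hik, hjk'⟩ := hc
    have hik := lt_of_le_of_ne hik (π.injective.ne (hij.trans hjk).ne')
    have hjk' := lt_of_le_of_ne hjk' (π.injective.ne hjk.ne')
    rcases lt_or_gt_of_ne (π.injective.ne hij.ne) with hlt | hlt
    · refine h₁ (containsPattern_of_triple hij hjk fun a b => ?_)
      fin_cases a <;> fin_cases b <;> simp [hik, hjk', hlt, hik.le, hjk'.le, hlt.le]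
    · refine h₂ (containsPattern_of_triple hij hjk fun a b => ?_)
      fin_cases a <;> fin_cases b <;> simp [hik, hjk', hlt, hik.le, hjk'.le, hlt.le]
  · intro h
    constructor
    all_goals
      rintro ⟨f, hf⟩
      have h₀ := h (f 0) (f 1) (f 2) (f.strictMono (by decide)) (f.strictMono (by decide))
      rw [hf, hf] at h₀
      revert h₀
      decide

lemma LastNotMin.mul_swap {n : ℕ} {π : Equiv.Perm (Fin (n + 2))} (h : LastNotMin π) :
    LastNotMin (π * Equiv.swap 0 1) := by
  intro i j k hij hjk
  have hk : Equiv.swap (0 : Fin (n + 2)) 1 k = k := by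
    apply Equiv.swap_apply_of_ne_of_ne <;> rintro rfl <;>
      simp only [Fin.lt_def, Fin.val_zero, Fin.val_one] at * <;> omega
  have hlt : ∀ x < k, Equiv.swap (0 : Fin (n + 2)) 1 x < k := by
    intro x hx
    rw [Equiv.swap_apply_def]
    split_ifs <;> simp only [Fin.lt_def, Fin.val_zero, Fin.val_one] at * <;> omega
  simp only [Equiv.Perm.mul_apply, hk]
  rcases lt_or_gt_of_ne ((Equiv.swap (0 : Fin (n + 2)) 1).injective.ne hij.ne) with hs | hs
  · exact h _ _ _ hs (hlt j hjk)
  · exact (h _ _ _ hs (hlt i (hij.trans hjk))).symm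

lemma LastNotMin.apply_zero_or_apply_one {n : ℕ} {π : Equiv.Perm (Fin (n + 2))}
    (h : LastNotMin π) : π 0 = 0 ∨ π 1 = 0 := by
  obtain ⟨k, hk⟩ := π.surjective 0
  by_cases h0 : k = 0
  · exact .inl (h0 ▸ hk)
  by_cases h1 : k = 1
  · exact .inr (h1 ▸ hk)
  have hk1 : 1 < k := by
    simp only [Fin.ext_iff, Fin.lt_def, Fin.val_zero, Fin.val_one] at *
    omega
  have := h 0 1 k (by simp) hk1
  simp [hk] at this

lemma lastNotMin_decomposeFin_symm_iff {n : ℕ} (e : Equiv.Perm (Fin n)) :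
    LastNotMin (Equiv.Perm.decomposeFin.symm (0, e)) ↔ LastNotMin e := by
  constructor
  · intro h i j k hij hjk
    simpa using h i.succ j.succ k.succ (by simpa) (by simpa)
  · intro h i j k hij hjk
    obtain ⟨j, rfl⟩ := Fin.exists_succ_eq.2 (Fin.ne_zero_of_lt hij)
    obtain ⟨k, rfl⟩ := Fin.exists_succ_eq.2 (Fin.ne_zero_of_lt hjk)
    rcases Fin.eq_zero_or_eq_succ i with rfl | ⟨i, rfl⟩
    · left; simp
    · simpa using h i j k (by simpa using hij) (by simpa using hjk)

lemma card_lastNotMin_apply_zero (n : ℕ) :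
    (Finset.univ.filter fun π : Equiv.Perm (Fin (n + 1)) => LastNotMin π ∧ π 0 = 0).card =
      (Finset.univ.filter fun π : Equiv.Perm (Fin n) => LastNotMin π).card := by
  symm
  refine Finset.card_bij (fun e _ => Equiv.Perm.decomposeFin.symm (0, e)) ?_ ?_ ?_
  · intro e he
    simpa [lastNotMin_decomposeFin_symm_iff] using he
  · intro e _ e' _ h
    simpa using h
  · intro π hπ
    obtain ⟨⟨p, e⟩, rfl⟩ := Equiv.Perm.decomposeFin.symm.surjective π
    simp only [Finset.mem_filter, Finset.mem_univ, true_and,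
      Equiv.Perm.decomposeFin_symm_apply_zero] at hπ
    obtain ⟨hπ, rfl⟩ := hπ
    exact ⟨e, by simpa [lastNotMin_decomposeFin_symm_iff] using hπ, rfl⟩

lemma card_lastNotMin_apply_one (n : ℕ) :
    (Finset.univ.filter fun π : Equiv.Perm (Fin (n + 2)) => LastNotMin π ∧ π 1 = 0).card =
      (Finset.univ.filter fun π : Equiv.Perm (Fin (n + 1)) => LastNotMin π).card := by
  rw [← card_lastNotMin_apply_zero]
  refine Finset.card_bij' (fun π _ => π * Equiv.swap 0 1) (fun π _ => π * Equiv.swap 0 1)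
    ?_ ?_ ?_ ?_
  · intro π hπ
    simp only [Finset.mem_filter, Finset.mem_univ, true_and] at hπ ⊢
    exact ⟨hπ.1.mul_swap, by simp [hπ.2]⟩
  · intro π hπ
    simp only [Finset.mem_filter, Finset.mem_univ, true_and] at hπ ⊢
    exact ⟨hπ.1.mul_swap, by simp [hπ.2]⟩
  · intro π _
    simp [mul_assoc]
  · intro π _
    simp [mul_assoc]

lemma card_lastNotMin (n : ℕ) :
    (Finset.univ.filter fun π : Equiv.Perm (Fin (n + 1)) => LastNotMin π).card = 2 ^ n := by
  induction n with
  | zero =>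
    rw [Finset.filter_true_of_mem]
    · simp
    · intro π _ i j k hij
      omega
  | succ n ih =>
    have hunion : (Finset.univ.filter fun π : Equiv.Perm (Fin (n + 2)) => LastNotMin π) =
        (Finset.univ.filter fun π : Equiv.Perm (Fin (n + 2)) => LastNotMin π ∧ π 0 = 0) ∪
        (Finset.univ.filter fun π : Equiv.Perm (Fin (n + 2)) => LastNotMin π ∧ π 1 = 0) := by
      ext π
      simp only [Finset.mem_union, Finset.mem_filter, Finset.mem_univ, true_and, ← and_or_left]
      exact ⟨fun h => ⟨h, h.apply_zero_or_apply_one⟩, And.left⟩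
    rw [hunion, Finset.card_union_of_disjoint, card_lastNotMin_apply_zero,
      card_lastNotMin_apply_one, ih, pow_succ, mul_two]
    rw [Finset.disjoint_filter]
    rintro π _ ⟨_, h₀⟩ ⟨_, h₁⟩
    simpa using π.injective (h₀.trans h₁.symm)

lemma LastNotMin.isDesarrangement_iff {n : ℕ} {π : Equiv.Perm (Fin (n + 2))}
    (h : LastNotMin π) : IsDesarrangement (n + 2) π ↔ π 1 = 0 := by
  constructor
  · rintro (h₀ | ⟨i, ⟨hi, _, hasc⟩, heven, hmin⟩)
    · omega
    · refine h.apply_zero_or_apply_one.resolve_left fun h₀ => ?_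
      have hpos : (0 : Fin (n + 2)) < π 1 := by
        rw [Fin.pos_iff_ne_zero, ← h₀]
        exact π.injective.ne (by simp)
      have : i ≤ 1 := hmin 1 ⟨le_rfl, by omega, .inr ⟨by omega, by
        change π 0 < π 1
        rwa [h₀]⟩⟩
      obtain rfl : i = 1 := by omega
      simp at heven
  · intro h₁
    refine .inr ⟨2, ⟨by omega, by omega, ?_⟩, even_two, ?_⟩
    · by_cases hn : n = 0
      · left; omega
      · refine .inr ⟨by omega, ?_⟩
        change π 1 < _
        rw [h₁, Fin.pos_iff_ne_zero, ← h₁]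
        exact π.injective.ne (by simp [Fin.ext_iff])
    · rintro j ⟨hj, _, hasc⟩
      by_contra! hj2
      obtain rfl : j = 1 := by omega
      rcases hasc with hasc | ⟨_, hasc⟩
      · omega
      · change π 0 < π 1 at hasc
        simp [h₁] at hasc

/-- For every integer `n ≥ 2`, `d_n({231, 321}) = 2^(n−2)`. -/
theorem desarrangements_avoiding_231_321 (n : ℕ) (hn : 2 ≤ n) :
    dcount n {![1,2,0], ![2,1,0]} = 2 ^ (n - 2) := by
  obtain ⟨m, rfl⟩ := Nat.exists_eq_add_of_le' hn
  rw [Nat.add_sub_cancel, ← card_lastNotMin, ← card_lastNotMin_apply_one, dcount]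
  congr 1
  ext π
  simp only [Finset.mem_filter, Finset.mem_univ, true_and, avoids_iff_lastNotMin]
  rw [and_comm]
  exact and_congr_right fun h => h.isDesarrangement_iff
end

section
/- For every integer n ≥ 3, the number of desarrangements of length n avoiding both patterns 312 and 321 equals 2^{n−3}, i.e. d_n({312, 321}) = 2^{n−3}. -/
open scoped Classical

/-- No letter of `π` is followed by two smaller letters. -/
def NoTwoSmallerAfter {n : ℕ} (π : Equiv.Perm (Fin n)) : Prop :=
  ∀ i j k : Fin n, i < j → j < k → π j < π i → ¬ π k < π i

theorem containsPattern_of_lt {n : ℕ} {π : Equiv.Perm (Fin n)} {σ : Fin 3 → Fin 3}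
    {i j k : Fin n} (hij : i < j) (hjk : j < k)
    (h : ∀ a b : Fin 3, π (![i, j, k] a) < π (![i, j, k] b) ↔ σ a < σ b) :
    ContainsPattern σ π := by
  have hmono : StrictMono ![i, j, k] := by
    intro a b hab
    fin_cases a <;> fin_cases b <;> simp_all [hij.trans hjk]
  exact ⟨OrderEmbedding.ofStrictMono _ hmono, h⟩

/-- Avoiding `312` and `321` means that no letter is followed by two smaller letters. -/
theorem avoids_iff_noTwoSmallerAfter {n : ℕ} (π : Equiv.Perm (Fin n)) :
    (∀ σ ∈ ({![2,0,1], ![2,1,0]} : Finset (Fin 3 → Fin 3)), ¬ ContainsPattern σ π) ↔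
      NoTwoSmallerAfter π := by
  simp only [Finset.mem_insert, Finset.mem_singleton, forall_eq_or_imp, forall_eq]
  constructor
  · rintro ⟨h1, h2⟩ i j k hij hjk hji hki
    rcases lt_trichotomy (π j) (π k) with h | h | h
    · refine h1 (containsPattern_of_lt hij hjk fun a b => ?_)
      fin_cases a <;> fin_cases b <;> simp [hji, hki, h, hji.le, hki.le, h.le]
    · exact hjk.ne (π.injective h)
    · refine h2 (containsPattern_of_lt hij hjk fun a b => ?_)
      fin_cases a <;> fin_cases b <;> simp [hji, hki, h, hji.le, hki.le, h.le]
  · intro h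
    constructor <;> rintro ⟨f, hf⟩ <;>
      exact h (f 0) (f 1) (f 2) (f.strictMono (by decide)) (f.strictMono (by decide))
        ((hf 1 0).2 (by decide)) ((hf 2 0).2 (by decide))

/-- The permutation with first letter `p` whose other letters are order-isomorphic to `σ`. -/
def consPerm {n : ℕ} (p : Fin (n + 1)) (σ : Equiv.Perm (Fin n)) : Equiv.Perm (Fin (n + 1)) :=
  (finSuccEquiv' 0).trans ((Equiv.optionCongr σ).trans (finSuccEquiv' p).symm)

@[simp]
theorem consPerm_zero {n : ℕ} (p : Fin (n + 1)) (σ : Equiv.Perm (Fin n)) :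
    consPerm p σ 0 = p := by
  simp [consPerm]

@[simp]
theorem consPerm_succ {n : ℕ} (p : Fin (n + 1)) (σ : Equiv.Perm (Fin n)) (i : Fin n) :
    consPerm p σ i.succ = p.succAbove (σ i) := by
  have h : finSuccEquiv' (0 : Fin (n + 1)) i.succ = some i := by
    rw [← Fin.succAbove_zero, finSuccEquiv'_succAbove]
  simp [consPerm, h]

theorem consPerm_injective {n : ℕ} :
    Function.Injective fun x : Fin (n + 1) × Equiv.Perm (Fin n) => consPerm x.1 x.2 := by
  rintro ⟨p, σ⟩ ⟨q, τ⟩ h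
  have hpq : p = q := by simpa using DFunLike.congr_fun h 0
  subst hpq
  have hστ : σ = τ := by
    ext1 i
    simpa using DFunLike.congr_fun h i.succ
  rw [hστ]

theorem exists_eq_consPerm {n : ℕ} (π : Equiv.Perm (Fin (n + 1))) :
    ∃ p σ, π = consPerm p σ := by
  have hb := (Fintype.bijective_iff_injective_and_card
    fun x : Fin (n + 1) × Equiv.Perm (Fin n) => consPerm x.1 x.2).2
      ⟨consPerm_injective, by simp [Fintype.card_perm, Nat.factorial_succ]⟩
  obtain ⟨⟨p, σ⟩, h⟩ := hb.2 π
  exact ⟨p, σ, h.symm⟩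

theorem noTwoSmallerAfter_consPerm {n : ℕ} (p : Fin (n + 1)) (σ : Equiv.Perm (Fin n)) :
    NoTwoSmallerAfter (consPerm p σ) ↔ (p : ℕ) ≤ 1 ∧ NoTwoSmallerAfter σ := by
  constructor
  · intro h
    refine ⟨?_, fun i j k hij hjk hji hki => h i.succ j.succ k.succ (by simpa) (by simpa)
      (by simpa using hji) (by simpa using hki)⟩
    by_contra! hp
    have hn := p.isLt
    have key : ∀ v : Fin (n + 1), (v : ℕ) ≤ 1 → ∃ a, 0 < a ∧ consPerm p σ a = v := by
      intro v hv
      refine ⟨(consPerm p σ).symm v, Fin.pos_of_ne_zero fun h0 => ?_, by simp⟩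
      have hpv := congrArg (consPerm p σ) h0
      rw [Equiv.apply_symm_apply, consPerm_zero] at hpv
      subst hpv
      omega
    obtain ⟨a, ha, hav⟩ := key ⟨0, by omega⟩ (by simp)
    obtain ⟨b, hb, hbv⟩ := key ⟨1, by omega⟩ (by simp)
    have ha' : consPerm p σ a < consPerm p σ 0 := by
      rw [hav, consPerm_zero, Fin.lt_def]
      exact (by omega : 0 < (p : ℕ))
    have hb' : consPerm p σ b < consPerm p σ 0 := by
      rw [hbv, consPerm_zero, Fin.lt_def]
      exact hp
    rcases lt_trichotomy a b with hab | hab | hab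
    · exact h 0 a b ha hab ha' hb'
    · subst hab
      simp [hav] at hbv
    · exact h 0 b a hb hab hb' ha'
  · rintro ⟨hp, h⟩ i j k hij hjk hji hki
    obtain ⟨j, rfl⟩ := Fin.exists_succ_eq.2 (Fin.ne_zero_of_lt hij)
    obtain ⟨k, rfl⟩ := Fin.exists_succ_eq.2 (Fin.ne_zero_of_lt hjk)
    rcases Fin.eq_zero_or_eq_succ i with rfl | ⟨i, rfl⟩
    · have hjk' : consPerm p σ j.succ = consPerm p σ k.succ := by
        rw [consPerm_zero, Fin.lt_def] at hji hki
        ext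
        omega
      exact hjk.ne ((consPerm p σ).injective hjk')
    · exact h i j k (by simpa using hij) (by simpa using hjk) (by simpa using hji)
        (by simpa using hki)

theorem card_noTwoSmallerAfter (m : ℕ) :
    (Finset.univ.filter fun π : Equiv.Perm (Fin (m + 1)) => NoTwoSmallerAfter π).card = 2 ^ m := by
  induction m with
  | zero =>
    rw [Finset.filter_true_of_mem]
    · simp
    · intro π _ i j k hij
      omega
  | succ m ih =>
    have himage : (Finset.univ.filter fun π : Equiv.Perm (Fin (m + 1 + 1)) => NoTwoSmallerAfter π) =
        (({0, 1} : Finset (Fin (m + 1 + 1))) ×ˢ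
          (Finset.univ.filter fun σ : Equiv.Perm (Fin (m + 1)) => NoTwoSmallerAfter σ)).image
          fun x => consPerm x.1 x.2 := by
      ext π
      simp only [Finset.mem_filter, Finset.mem_univ, true_and, Finset.mem_image,
        Finset.mem_product, Finset.mem_insert, Finset.mem_singleton, Prod.exists]
      constructor
      · intro h
        obtain ⟨p, σ, rfl⟩ := exists_eq_consPerm π
        rw [noTwoSmallerAfter_consPerm] at h
        refine ⟨p, σ, ⟨?_, h.2⟩, rfl⟩
        simp only [Fin.ext_iff, Fin.val_zero, Fin.val_one]
        omega
      · rintro ⟨p, σ, ⟨hp, hσ⟩, rfl⟩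
        rw [noTwoSmallerAfter_consPerm]
        refine ⟨?_, hσ⟩
        rcases hp with rfl | rfl <;> simp
    rw [himage, Finset.card_image_of_injective _ consPerm_injective, Finset.card_product, ih,
      Finset.card_pair (by simp), pow_succ, mul_comm]

theorem isDesarrangement_iff_of_noTwoSmallerAfter {m : ℕ} {π : Equiv.Perm (Fin (m + 3))}
    (h : NoTwoSmallerAfter π) : IsDesarrangement (m + 3) π ↔ π 1 < π 0 := by
  constructor
  · rintro (h0 | ⟨i, hi, he, hmin⟩)
    · omega
    · by_contra! hle
      have hlt : π 0 < π 1 := lt_of_le_of_ne hle (π.injective.ne (by simp))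
      have h1 := hmin 1 ⟨le_rfl, by omega, Or.inr ⟨by omega, hlt⟩⟩
      have h2 := hi.1
      obtain rfl : i = 1 := by omega
      exact absurd he (by decide)
  · intro hlt
    have h12 : (1 : Fin (m + 3)) < 2 := by
      rw [Fin.lt_def, Fin.val_one, Fin.val_two]
      exact one_lt_two
    refine Or.inr ⟨2, ⟨by omega, by omega, Or.inr ⟨by omega, ?_⟩⟩, even_two, ?_⟩
    · change π 1 < π 2
      by_contra! hle
      exact h 0 1 2 (by simp) h12 hlt (hle.trans_lt hlt)
    · rintro j ⟨hj, -, hj'⟩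
      by_contra! hj2
      obtain rfl : j = 1 := by omega
      rcases hj' with hj' | ⟨_, hj'⟩
      · omega
      · exact lt_asymm hlt hj'

/-- For every integer `n ≥ 3`, `d_n({312, 321}) = 2^(n−3)`. -/
theorem desarrangements_avoiding_312_321 (n : ℕ) (hn : 3 ≤ n) :
    dcount n {![2,0,1], ![2,1,0]} = 2 ^ (n - 3) := by
  obtain ⟨m, rfl⟩ : ∃ m, n = m + 3 := ⟨n - 3, by omega⟩
  rw [Nat.add_sub_cancel, ← card_noTwoSmallerAfter m, dcount]
  have hinj : Function.Injective fun σ : Equiv.Perm (Fin (m + 1)) =>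
      consPerm (1 : Fin (m + 3)) (consPerm 0 σ) := by
    intro σ τ h
    have h1 := consPerm_injective (a₁ := (1, consPerm 0 σ)) (a₂ := (1, consPerm 0 τ)) h
    have h2 := consPerm_injective (a₁ := (0, σ)) (a₂ := (0, τ)) (Prod.ext_iff.1 h1).2
    exact (Prod.ext_iff.1 h2).2
  rw [← Finset.card_image_of_injective _ hinj]
  congr 1
  ext π
  simp only [avoids_iff_noTwoSmallerAfter, Finset.mem_filter, Finset.mem_univ, true_and,
    Finset.mem_image]
  constructor
  · rintro ⟨hd, hπ⟩
    rw [isDesarrangement_iff_of_noTwoSmallerAfter hπ] at hd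
    obtain ⟨p, τ, rfl⟩ := exists_eq_consPerm π
    obtain ⟨q, σ, rfl⟩ := exists_eq_consPerm τ
    rw [noTwoSmallerAfter_consPerm, noTwoSmallerAfter_consPerm] at hπ
    obtain ⟨hp, -, hσ⟩ := hπ
    rw [← Fin.succ_zero_eq_one, consPerm_succ, consPerm_zero, consPerm_zero,
      Fin.succAbove_lt_iff_castSucc_lt, Fin.lt_def, Fin.val_castSucc] at hd
    obtain rfl : p = 1 := Fin.ext (by rw [Fin.val_one]; omega)
    obtain rfl : q = 0 := Fin.ext (by rw [Fin.val_zero]; omega)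
    exact ⟨σ, hσ, rfl⟩
  · rintro ⟨σ, hσ, rfl⟩
    have hπ : NoTwoSmallerAfter (consPerm (1 : Fin (m + 3)) (consPerm 0 σ)) := by
      simp [noTwoSmallerAfter_consPerm, hσ]
    refine ⟨(isDesarrangement_iff_of_noTwoSmallerAfter hπ).2 ?_, hπ⟩
    rw [← Fin.succ_zero_eq_one, consPerm_succ, consPerm_zero, consPerm_zero,
      Fin.succAbove_lt_iff_castSucc_lt]
    simp
end
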